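/- Assume in addition that for every μ ∈ ℝⁿ with μ ≠ 0, the solution t ↦ Σ_{j=1}^{n} μ_j x_{−,j}(t) does not tend to 0 as t → −∞ (this is the transversality of the stable and unstable subspaces, E_s ∩ E_u = {0}). Then there exists k > 0 such that for all μ ∈ ℝⁿ and all t ∈ ℝ, one has |Σ_{j=1}^{n} μ_j x_{−,j}(t)| ≥ k·|μ|·e^{−t}. -/

import Mathlib

open Real Filter Topology

noncomputable section

/-- The phase space `ℝ^{2n} = ℝⁿ × ℝⁿ` with the Euclidean norm. -/
abbrev EucV (n : ℕ) := EuclideanSpace ℝ (Fin n ⊕ Fin n)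

/-- The block matrix `A = [[0, I],[I, 0]]`, i.e. `A (y, z) = (z, y)`. -/
def Amap (n : ℕ) : EucV n →L[ℝ] EucV n :=
  LinearMap.toContinuousLinearMap
    { toFun := fun x => (WithLp.equiv 2 _).symm fun i => x i.swap
      map_add' := fun _ _ => rfl
      map_smul' := fun _ _ => rfl }

/-- `x` is a solution of `x′(t) = (A + E(t))·x(t)`. -/
def IsSol (n : ℕ) (E : ℝ → (EucV n →L[ℝ] EucV n)) (x : ℝ → EucV n) : Prop :=
  ∀ t : ℝ, HasDerivAt x (Amap n (x t) + E t (x t)) t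

/-- The eigenvector `e_j^σ = (e_j, σ e_j)` of `A`, for `σ = ±1`. -/
def eVec (n : ℕ) (σ : ℝ) (j : Fin n) : EucV n :=
  EuclideanSpace.single (Sum.inl j) (1 : ℝ) + EuclideanSpace.single (Sum.inr j) σ

section Asymptotics

variable {V : Type*} [NormedAddCommGroup V] [InnerProductSpace ℝ V]

/-- Mean value inequality: a curve whose speed is at most `c e^{bt}` on `(-∞, 0]`, with `b ≠ 0`. -/
theorem norm_sub_le_of_norm_deriv_le_exp {f f' : ℝ → V} {b c : ℝ} (hb : b ≠ 0)
    (hf : ∀ t, HasDerivAt f (f' t) t) (hbd : ∀ t ≤ 0, ‖f' t‖ ≤ c * exp (b * t))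
    {s t : ℝ} (hst : s ≤ t) (ht : t ≤ 0) :
    ‖f t - f s‖ ≤ c / b * (exp (b * t) - exp (b * s)) := by
  have key := image_norm_le_of_norm_deriv_right_le_deriv_boundary
    (f := fun r => f r - f s) (f' := f') (a := s) (b := t)
    (B := fun r => c / b * (exp (b * r) - exp (b * s))) (B' := fun r => c * exp (b * r))
    (fun r _ => ((hf r).sub_const _).continuousAt.continuousWithinAt)
    (fun r _ => ((hf r).sub_const _).hasDerivWithinAt) (by simp)
    (fun r => by
      have h := ((((hasDerivAt_id r).const_mul b).exp.sub_const (exp (b * s))).const_mul (c / b))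
      refine h.congr_deriv ?_
      simp only [id]
      field_simp)
    (fun r hr => hbd r (hr.2.le.trans ht))
  exact key ⟨hst, le_rfl⟩

/-- `e^{bt} → 0` as `t → -∞` when `b > 0`. -/
theorem tendsto_exp_mul_atBot {b : ℝ} (hb : 0 < b) :
    Tendsto (fun t : ℝ => exp (b * t)) atBot (𝓝 0) :=
  tendsto_exp_atBot.comp (tendsto_id.const_mul_atBot hb)

/-- A function with exponentially decaying derivative at `-∞` converges exponentially fast. -/
theorem exists_norm_sub_le_exp_of_norm_deriv_le_exp [CompleteSpace V] {f f' : ℝ → V} {b c : ℝ}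
    (hb : 0 < b) (hf : ∀ t, HasDerivAt f (f' t) t) (hbd : ∀ t ≤ 0, ‖f' t‖ ≤ c * exp (b * t)) :
    ∃ L, ∀ t ≤ 0, ‖f t - L‖ ≤ c / b * exp (b * t) := by
  have hc : 0 ≤ c := by simpa using (norm_nonneg _).trans (hbd 0 le_rfl)
  have hdiff : ∀ s t, s ≤ t → t ≤ 0 → ‖f t - f s‖ ≤ c / b * exp (b * t) := fun s t hst ht =>
    (norm_sub_le_of_norm_deriv_le_exp hb.ne' hf hbd hst ht).trans
      (mul_le_mul_of_nonneg_left (by linarith [exp_pos (b * s)]) (by positivity))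
  have hlim : Tendsto (fun t : ℝ => c / b * exp (b * t)) atBot (𝓝 0) := by
    simpa using (tendsto_exp_mul_atBot hb).const_mul (c / b)
  have hcauchy : Cauchy (map f atBot) := by
    rw [Metric.cauchy_iff]
    refine ⟨inferInstance, fun ε hε => ?_⟩
    obtain ⟨T, hT, hT0⟩ := ((hlim.eventually_lt_const (half_pos hε)).and
      (eventually_le_atBot 0)).exists
    refine ⟨f '' Set.Iic T, image_mem_map (Iic_mem_atBot T), ?_⟩
    rintro _ ⟨s, hs, rfl⟩ _ ⟨t, ht, rfl⟩
    have h1 := hdiff s T hs hT0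
    have h2 := hdiff t T ht hT0
    have h3 := dist_triangle_left (f s) (f t) (f T)
    rw [dist_eq_norm (f T), dist_eq_norm (f T)] at h3
    linarith
  obtain ⟨L, hL⟩ := CompleteSpace.complete hcauchy
  refine ⟨L, fun t ht => ?_⟩
  have hL' : Tendsto f atBot (𝓝 L) := hL
  refine le_of_tendsto (hL'.const_sub (f t)).norm ?_
  filter_upwards [eventually_le_atBot t] with s hs using hdiff s t hs ht

/-- Decay at `-∞` of solutions of `u′ = 2u + O(e^{bt})` with `b < 2`. -/
theorem exists_norm_le_exp_of_norm_deriv_sub_le_exp {u u' : ℝ → V} {b c : ℝ} (hb : b < 2)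
    (hu : ∀ t, HasDerivAt u (u' t) t)
    (hbd : ∀ t ≤ 0, ‖u' t - (2 : ℝ) • u t‖ ≤ c * exp (b * t)) :
    ∃ K, ∀ t ≤ 0, ‖u t‖ ≤ K * exp (b * t) := by
  have hc : 0 ≤ c := by simpa using (norm_nonneg _).trans (hbd 0 le_rfl)
  have hg : ∀ t, HasDerivAt (fun t => exp (-2 * t) • u t)
      (exp (-2 * t) • (u' t - (2 : ℝ) • u t)) t := fun t => by
    have h := ((hasDerivAt_id t).const_mul (-2 : ℝ)).exp.smul (hu t)
    refine h.congr_deriv ?_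
    simp only [id]
    module
  have hgbd : ∀ t ≤ 0, ‖exp (-2 * t) • (u' t - (2 : ℝ) • u t)‖ ≤ c * exp ((b - 2) * t) := by
    intro t ht
    rw [norm_smul, norm_of_nonneg (exp_pos _).le]
    calc exp (-2 * t) * ‖u' t - (2 : ℝ) • u t‖ ≤ exp (-2 * t) * (c * exp (b * t)) := by
          gcongr; exact hbd t ht
      _ = c * exp ((b - 2) * t) := by
          rw [mul_left_comm, ← exp_add]; ring_nf
  refine ⟨‖u 0‖ + c / (2 - b), fun t ht => ?_⟩
  have h := norm_sub_le_of_norm_deriv_le_exp (sub_neg.2 hb).ne hg hgbd ht le_rfl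
  have hb' : 0 < 2 - b := by linarith
  have hcb : 0 ≤ c / (2 - b) := by positivity
  have hneg : c / (b - 2) = -(c / (2 - b)) := by rw [← div_neg, neg_sub]
  simp only [mul_zero, exp_zero, one_smul] at h
  rw [hneg] at h
  have h1 : ‖exp (-2 * t) • u t‖ ≤ ‖u 0‖ + c / (2 - b) * exp ((b - 2) * t) := by
    have h2 := norm_le_norm_add_norm_sub' (exp (-2 * t) • u t) (u 0)
    rw [norm_sub_rev] at h2
    linarith
  rw [norm_smul, norm_of_nonneg (exp_pos _).le] at h1
  have he : exp ((b - 2) * t) = exp (-2 * t) * exp (b * t) := by rw [← exp_add]; ring_nf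
  have hge : 1 ≤ exp ((b - 2) * t) := one_le_exp (mul_nonneg_of_nonpos_of_nonpos (by linarith) ht)
  have h3 : exp (-2 * t) * ‖u t‖ ≤ exp (-2 * t) * ((‖u 0‖ + c / (2 - b)) * exp (b * t)) :=
    calc exp (-2 * t) * ‖u t‖ ≤ ‖u 0‖ * exp ((b - 2) * t) + c / (2 - b) * exp ((b - 2) * t) :=
          h1.trans (by gcongr; exact le_mul_of_one_le_right (norm_nonneg _) hge)
      _ = _ := by rw [he]; ring
  exact le_of_mul_le_mul_left h3 (exp_pos _)

variable {S : V →L[ℝ] V} {E : ℝ → V →L[ℝ] V} {C : ℝ} {z : ℝ → V}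

/-- Backward boundedness of rescaled solutions `z = e^t x`, by an energy estimate. -/
theorem exists_norm_le_of_rescaled_solution (hSn : ∀ v, ‖S v‖ = ‖v‖)
    (hE : ∀ t ≤ 0, ‖E t‖ ≤ C * exp t) (hz : ∀ t, HasDerivAt z (S (z t) + z t + E t (z t)) t) :
    ∃ M, ∀ t ≤ 0, ‖z t‖ ≤ M := by
  have hd : ∀ t, HasDerivAt (fun t => exp (2 * C * exp t) * ‖z t‖ ^ 2)
      (exp (2 * C * exp t) * (2 * C * exp t) * ‖z t‖ ^ 2 +
        exp (2 * C * exp t) * (2 * inner ℝ (z t) (S (z t) + z t + E t (z t)))) t := fun t =>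
    ((hasDerivAt_exp t).const_mul (2 * C)).exp.mul (hz t).norm_sq
  have hmono : MonotoneOn (fun t => exp (2 * C * exp t) * ‖z t‖ ^ 2) (Set.Iic 0) := by
    refine monotoneOn_of_hasDerivWithinAt_nonneg (convex_Iic 0)
      (fun t _ => (hd t).continuousAt.continuousWithinAt) (fun t _ => (hd t).hasDerivWithinAt) ?_
    intro t ht
    have ht0 : t ∈ Set.Iic 0 := interior_subset ht
    have h1 : -(‖z t‖ * ‖z t‖) ≤ inner ℝ (z t) (S (z t)) := by
      have := abs_real_inner_le_norm (z t) (S (z t))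
      rw [hSn] at this
      exact (abs_le.1 this).1
    have h2 : -(‖z t‖ * (C * exp t * ‖z t‖)) ≤ inner ℝ (z t) (E t (z t)) := by
      refine (abs_le.1 ((abs_real_inner_le_norm (z t) (E t (z t))).trans ?_)).1
      exact mul_le_mul_of_nonneg_left ((E t).le_of_opNorm_le (hE t ht0) _) (norm_nonneg _)
    rw [inner_add_right, inner_add_right, real_inner_self_eq_norm_sq]
    have : 0 ≤ 2 * C * exp t * ‖z t‖ ^ 2 + 2 * (inner ℝ (z t) (S (z t)) + ‖z t‖ ^ 2 +
        inner ℝ (z t) (E t (z t))) := by nlinarith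
    have := mul_nonneg (exp_pos (2 * C * exp t)).le this
    linarith
  have hC : 0 ≤ C := by simpa using (norm_nonneg _).trans (hE 0 le_rfl)
  refine ⟨√(exp (2 * C * exp 0) * ‖z 0‖ ^ 2), fun t ht => le_sqrt_of_sq_le ?_⟩
  refine le_trans ?_ (hmono ht (Set.mem_Iic.2 le_rfl) ht)
  exact le_mul_of_one_le_left (sq_nonneg _) (one_le_exp (by positivity))

/-- A rescaled solution of size `O(e^{at})`, `0 ≤ a < 1`, converges at `-∞` at rate
`O(e^{(1+a)t})`. -/
theorem exists_norm_sub_le_exp_of_rescaled_solution [CompleteSpace V] (hSS : ∀ v, S (S v) = v)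
    (hSn : ∀ v, ‖S v‖ = ‖v‖) (hE : ∀ t ≤ 0, ‖E t‖ ≤ C * exp t)
    (hz : ∀ t, HasDerivAt z (S (z t) + z t + E t (z t)) t) {a M : ℝ} (ha : 0 ≤ a) (ha1 : a < 1)
    (hM : ∀ t ≤ 0, ‖z t‖ ≤ M * exp (a * t)) :
    ∃ L K, ∀ t ≤ 0, ‖z t - L‖ ≤ K * exp ((1 + a) * t) := by
  have hC : 0 ≤ C := by simpa using (norm_nonneg _).trans (hE 0 le_rfl)
  have hEz : ∀ t ≤ 0, ‖E t (z t)‖ ≤ C * M * exp ((1 + a) * t) := fun t ht =>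
    calc ‖E t (z t)‖ ≤ C * exp t * (M * exp (a * t)) :=
          ((E t).le_of_opNorm_le (hE t ht) _).trans
            (mul_le_mul_of_nonneg_left (hM t ht) (by positivity))
      _ = C * M * exp ((1 + a) * t) := by rw [one_add_mul, exp_add]; ring
  have hSz : ∀ t, HasDerivAt (fun t => S (z t)) (S (S (z t) + z t + E t (z t))) t := fun t =>
    S.hasFDerivAt.comp_hasDerivAt t (hz t)
  obtain ⟨L, hL⟩ := exists_norm_sub_le_exp_of_norm_deriv_le_exp (b := 1 + a) (c := 2 * (C * M))
    (by linarith) (fun t => (hz t).sub (hSz t)) (fun t ht => by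
      have : S (z t) + z t + E t (z t) - S (S (z t) + z t + E t (z t)) =
          E t (z t) - S (E t (z t)) := by
        simp only [map_add, hSS]; abel
      rw [this]
      refine (norm_sub_le _ _).trans ?_
      rw [hSn]
      linarith [hEz t ht])
  obtain ⟨K, hK⟩ := exists_norm_le_exp_of_norm_deriv_sub_le_exp (b := 1 + a) (c := 2 * (C * M))
    (by linarith) (fun t => (hz t).add (hSz t)) (fun t ht => by
      have : S (z t) + z t + E t (z t) + S (S (z t) + z t + E t (z t)) -
          (2 : ℝ) • (z t + S (z t)) = E t (z t) + S (E t (z t)) := by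
        simp only [map_add, hSS]; module
      simp only [Pi.add_apply]
      rw [this]
      refine (norm_add_le _ _).trans ?_
      rw [hSn]
      linarith [hEz t ht])
  refine ⟨(2⁻¹ : ℝ) • L, 2⁻¹ * (2 * (C * M) / (1 + a) + K), fun t ht => ?_⟩
  have hsplit : z t - (2⁻¹ : ℝ) • L =
      (2⁻¹ : ℝ) • ((z t - S (z t) - L) + (z t + S (z t))) := by module
  rw [hsplit, norm_smul, norm_of_nonneg (by norm_num : (0 : ℝ) ≤ 2⁻¹)]
  have h1 := hL t ht
  have h2 := hK t ht
  simp only [Pi.add_apply, Pi.sub_apply] at h1 h2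
  have h3 := norm_add_le (z t - S (z t) - L) (z t + S (z t))
  linarith

/-- A function within `O(e^{bt})` of `L`, `b > 0`, tends to `L` at `-∞`. -/
theorem tendsto_atBot_of_norm_sub_le_exp {W : Type*} [SeminormedAddCommGroup W] {f : ℝ → W} {L : W}
    {K b : ℝ} (hb : 0 < b)
    (h : ∀ t ≤ 0, ‖f t - L‖ ≤ K * exp (b * t)) : Tendsto f atBot (𝓝 L) := by
  rw [tendsto_iff_norm_sub_tendsto_zero]
  refine squeeze_zero' (Eventually.of_forall fun _ => norm_nonneg _)
    ((eventually_le_atBot 0).mono h) ?_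
  simpa using (tendsto_exp_mul_atBot hb).const_mul K

/-- Rescaled solutions converge at `-∞`. -/
theorem exists_tendsto_atBot_of_rescaled_solution [CompleteSpace V] (hSS : ∀ v, S (S v) = v)
    (hSn : ∀ v, ‖S v‖ = ‖v‖) (hE : ∀ t ≤ 0, ‖E t‖ ≤ C * exp t)
    (hz : ∀ t, HasDerivAt z (S (z t) + z t + E t (z t)) t) :
    ∃ L, Tendsto z atBot (𝓝 L) := by
  obtain ⟨M, hM⟩ := exists_norm_le_of_rescaled_solution hSn hE hz
  obtain ⟨L, K, hLK⟩ := exists_norm_sub_le_exp_of_rescaled_solution hSS hSn hE hz le_rfl one_pos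
    (M := M) (by simpa using hM)
  exact ⟨L, tendsto_atBot_of_norm_sub_le_exp (by norm_num) hLK⟩

/-- If a rescaled solution `z = e^t x` vanishes at `-∞`, then so does `x` itself. -/
theorem tendsto_exp_neg_smul_of_rescaled_solution [CompleteSpace V] (hSS : ∀ v, S (S v) = v)
    (hSn : ∀ v, ‖S v‖ = ‖v‖) (hE : ∀ t ≤ 0, ‖E t‖ ≤ C * exp t)
    (hz : ∀ t, HasDerivAt z (S (z t) + z t + E t (z t)) t) (hz0 : Tendsto z atBot (𝓝 0)) :
    Tendsto (fun t => exp (-t) • z t) atBot (𝓝 0) := by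
  obtain ⟨M, hM⟩ := exists_norm_le_of_rescaled_solution hSn hE hz
  obtain ⟨L, K, hLK⟩ := exists_norm_sub_le_exp_of_rescaled_solution hSS hSn hE hz le_rfl one_pos
    (M := M) (by simpa using hM)
  obtain rfl : L = 0 :=
    tendsto_nhds_unique (tendsto_atBot_of_norm_sub_le_exp (by norm_num) hLK) hz0
  have hK : 0 ≤ K := by simpa using (norm_nonneg _).trans (hLK 0 le_rfl)
  obtain ⟨L, K', hLK'⟩ := exists_norm_sub_le_exp_of_rescaled_solution hSS hSn hE hz
    (a := 1 / 2) (M := K) (by norm_num) (by norm_num) (fun t ht => by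
      have h := hLK t ht
      rw [sub_zero] at h
      exact h.trans (mul_le_mul_of_nonneg_left (exp_le_exp.2 (by linarith)) hK))
  obtain rfl : L = 0 :=
    tendsto_nhds_unique (tendsto_atBot_of_norm_sub_le_exp (by norm_num) hLK') hz0
  refine tendsto_atBot_of_norm_sub_le_exp (b := 1 / 2) (K := K') (by norm_num) fun t ht => ?_
  have h := hLK' t ht
  rw [sub_zero] at h ⊢
  rw [norm_smul, norm_of_nonneg (exp_pos _).le]
  calc exp (-t) * ‖z t‖ ≤ exp (-t) * (K' * exp ((1 + 1 / 2) * t)) := by gcongr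
    _ = K' * exp (1 / 2 * t) := by rw [mul_left_comm, ← exp_add]; ring_nf

end Asymptotics

/-- Linear independence is quantitatively stable: families close to a linearly independent one
satisfy a common lower bound. -/
theorem exists_eventually_mul_norm_le_norm_sum {ι α V : Type*} [Fintype ι] [NormedAddCommGroup V]
    [NormedSpace ℝ V] {l : Filter α} {v : α → ι → V} {w : ι → V}
    (hv : ∀ j, Tendsto (fun t => v t j) l (𝓝 (w j)))
    (hw : ∀ mu : EuclideanSpace ℝ ι, ∑ j, mu j • w j = 0 → mu = 0) :
    ∃ c : ℝ, 0 < c ∧ ∀ᶠ t in l, ∀ mu : EuclideanSpace ℝ ι, c * ‖mu‖ ≤ ‖∑ j, mu j • v t j‖ := by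
  let T : EuclideanSpace ℝ ι →ₗ[ℝ] V :=
    { toFun := fun mu => ∑ j, mu j • w j
      map_add' := fun a b => by simp [add_smul, Finset.sum_add_distrib]
      map_smul' := fun a b => by simp [mul_smul, Finset.smul_sum] }
  obtain ⟨K, hK0, hK⟩ := T.exists_antilipschitzWith (LinearMap.ker_eq_bot'.2 hw)
  have hK0' : (0 : ℝ) < K := hK0
  have hT : ∀ mu : EuclideanSpace ℝ ι, ‖mu‖ ≤ K * ‖∑ j, mu j • w j‖ := fun mu =>
    ZeroHomClass.bound_of_antilipschitz T hK mu
  have hsum : Tendsto (fun t => ∑ j, ‖v t j - w j‖) l (𝓝 0) := by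
    have := tendsto_finsetSum Finset.univ fun j _ => tendsto_iff_norm_sub_tendsto_zero.1 (hv j)
    simpa using this
  refine ⟨(K : ℝ)⁻¹ / 2, by positivity, ?_⟩
  filter_upwards [hsum.eventually_lt_const (show (0 : ℝ) < (K : ℝ)⁻¹ / 2 by positivity)]
    with t ht mu
  have h1 : (K : ℝ)⁻¹ * ‖mu‖ ≤ ‖∑ j, mu j • w j‖ := (inv_mul_le_iff₀ hK0').2 (hT mu)
  have h2 : ‖∑ j, mu j • (v t j - w j)‖ ≤ (∑ j, ‖v t j - w j‖) * ‖mu‖ := by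
    rw [Finset.sum_mul]
    refine norm_sum_le_of_le _ fun j _ => ?_
    rw [norm_smul, mul_comm]
    exact mul_le_mul_of_nonneg_left (PiLp.norm_apply_le mu j) (norm_nonneg _)
  have h3 : ‖∑ j, mu j • w j‖ ≤ ‖∑ j, mu j • v t j‖ + ‖∑ j, mu j • (v t j - w j)‖ := by
    have : ∑ j, mu j • w j = ∑ j, mu j • v t j - ∑ j, mu j • (v t j - w j) := by
      rw [← Finset.sum_sub_distrib]
      exact Finset.sum_congr rfl fun j _ => by module
    rw [this]
    exact norm_sub_le _ _
  have h4 := mul_le_mul_of_nonneg_right ht.le (norm_nonneg mu)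
  linarith

/-- A curve of families that are linearly independent at every time and in both limits satisfies
a uniform lower bound. -/
theorem exists_mul_norm_le_norm_sum {ι V : Type*} [Fintype ι] [NormedAddCommGroup V]
    [NormedSpace ℝ V] {v : ℝ → ι → V} {wbot wtop : ι → V}
    (hv : ∀ j, Continuous fun t => v t j)
    (hbot : ∀ j, Tendsto (fun t => v t j) atBot (𝓝 (wbot j)))
    (htop : ∀ j, Tendsto (fun t => v t j) atTop (𝓝 (wtop j)))
    (hv0 : ∀ (t : ℝ) (mu : EuclideanSpace ℝ ι), ∑ j, mu j • v t j = 0 → mu = 0)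
    (hbot0 : ∀ mu : EuclideanSpace ℝ ι, ∑ j, mu j • wbot j = 0 → mu = 0)
    (htop0 : ∀ mu : EuclideanSpace ℝ ι, ∑ j, mu j • wtop j = 0 → mu = 0) :
    ∃ c : ℝ, 0 < c ∧ ∀ (mu : EuclideanSpace ℝ ι) (t : ℝ), c * ‖mu‖ ≤ ‖∑ j, mu j • v t j‖ := by
  obtain ⟨c₁, hc₁, h₁⟩ := exists_eventually_mul_norm_le_norm_sum hbot hbot0
  obtain ⟨c₂, hc₂, h₂⟩ := exists_eventually_mul_norm_le_norm_sum htop htop0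
  obtain ⟨a, ha⟩ := eventually_atBot.1 h₁
  obtain ⟨b, hb⟩ := eventually_atTop.1 h₂
  obtain ⟨c₃, hc₃, h₃⟩ : ∃ c : ℝ, 0 < c ∧ ∀ t ∈ Set.Icc a b, ∀ mu : EuclideanSpace ℝ ι,
      c * ‖mu‖ ≤ ‖∑ j, mu j • v t j‖ := by
    refine isCompact_Icc.induction_on (p := fun s => ∃ c : ℝ, 0 < c ∧ ∀ t ∈ s,
      ∀ mu : EuclideanSpace ℝ ι, c * ‖mu‖ ≤ ‖∑ j, mu j • v t j‖) ⟨1, one_pos, by simp⟩ ?_ ?_ ?_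
    · rintro s t hst ⟨c, hc, h⟩
      exact ⟨c, hc, fun r hr => h r (hst hr)⟩
    · rintro s t ⟨c, hc, h⟩ ⟨d, hd, h'⟩
      refine ⟨min c d, lt_min hc hd, ?_⟩
      rintro r (hr | hr) mu
      · exact (mul_le_mul_of_nonneg_right (min_le_left _ _) (norm_nonneg _)).trans (h r hr mu)
      · exact (mul_le_mul_of_nonneg_right (min_le_right _ _) (norm_nonneg _)).trans (h' r hr mu)
    · intro t _
      obtain ⟨c, hc, h⟩ :=
        exists_eventually_mul_norm_le_norm_sum (fun j => (hv j).tendsto t) (hv0 t)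
      exact ⟨_, mem_nhdsWithin_of_mem_nhds h, c, hc, fun r hr => hr⟩
  refine ⟨min c₁ (min c₂ c₃), lt_min hc₁ (lt_min hc₂ hc₃), fun mu t => ?_⟩
  have hle : ∀ c, min c₁ (min c₂ c₃) ≤ c → c * ‖mu‖ ≤ ‖∑ j, mu j • v t j‖ →
      min c₁ (min c₂ c₃) * ‖mu‖ ≤ ‖∑ j, mu j • v t j‖ := fun c hc h =>
    (mul_le_mul_of_nonneg_right hc (norm_nonneg _)).trans h
  rcases le_total t a with hta | hta
  · exact hle c₁ (min_le_left _ _) (ha t hta mu)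
  rcases le_total b t with hbt | hbt
  · exact hle c₂ ((min_le_right _ _).trans (min_le_left _ _)) (hb t hbt mu)
  · exact hle c₃ ((min_le_right _ _).trans (min_le_right _ _)) (h₃ t ⟨hta, hbt⟩ mu)

theorem Amap_Amap (n : ℕ) (v : EucV n) : Amap n (Amap n v) = v := by
  ext i
  simp [Amap]

theorem norm_Amap (n : ℕ) (v : EucV n) : ‖Amap n v‖ = ‖v‖ := by
  simp [Amap, EuclideanSpace.norm_eq, Fintype.sum_sum_type, add_comm]

/-- The vectors `e_j^σ` are linearly independent. -/
theorem eq_zero_of_sum_smul_eVec_eq_zero {n : ℕ} {σ : ℝ} (mu : EuclideanSpace ℝ (Fin n))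
    (h : ∑ j, mu j • eVec n σ j = 0) : mu = 0 := by
  ext i
  have := congrArg (fun v : EucV n => v (Sum.inl i)) h
  simpa [eVec, Pi.single_apply] using this

/-- Solutions are closed under linear combinations. -/
theorem IsSol.sum_smul {n : ℕ} {E : ℝ → (EucV n →L[ℝ] EucV n)} {ι : Type*} [Fintype ι]
    {x : ι → ℝ → EucV n} (hx : ∀ j, IsSol n E (x j)) (mu : ι → ℝ) :
    IsSol n E fun t => ∑ j, mu j • x j t := fun t => by
  refine (HasDerivAt.fun_sum fun j _ => (hx j t).const_smul (mu j)).congr_deriv ?_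
  simp [map_sum, Finset.sum_add_distrib]

/-- A solution that vanishes at one time vanishes identically. -/
theorem IsSol.eq_zero {n : ℕ} {E : ℝ → (EucV n →L[ℝ] EucV n)} {C : ℝ} (hE : ∀ t, ‖E t‖ ≤ C)
    {x : ℝ → EucV n} (hx : IsSol n E x) {t₀ : ℝ} (h0 : x t₀ = 0) : x = 0 := by
  refine ODE_solution_unique_univ (v := fun t v => (Amap n + E t) v) (s := fun _ => Set.univ)
    (K := (‖Amap n‖ + C).toNNReal) (t₀ := t₀) (fun t => ?_) (fun t => ⟨hx t, trivial⟩)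
    (fun t => ⟨?_, trivial⟩) h0
  · refine ((Amap n + E t).lipschitz.weaken ?_).lipschitzOnWith
    rw [← NNReal.coe_le_coe, coe_nnnorm]
    exact ((norm_add_le _ _).trans (by gcongr; exact hE t)).trans (le_coe_toNNReal _)
  · simp

/-- The equation satisfied by the rescaled solution `e^t x(t)`. -/
theorem IsSol.hasDerivAt_exp_smul {n : ℕ} {E : ℝ → (EucV n →L[ℝ] EucV n)} {x : ℝ → EucV n}
    (hx : IsSol n E x) (t : ℝ) :
    HasDerivAt (fun t => exp t • x t)
      (Amap n (exp t • x t) + exp t • x t + E t (exp t • x t)) t := by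
  refine ((hasDerivAt_exp t).smul (hx t)).congr_deriv ?_
  simp only [map_smul]
  module

/-- Under transversality of the stable and unstable subspaces (no nonzero combination of the
decaying solutions tends to `0` as `t → −∞`), one has the uniform lower bound
`|Σ μ_j x_{−,j}(t)| ≥ k |μ| e^{−t}`. -/
theorem lower_bound_stable_combination
    (n : ℕ) (hn : 1 ≤ n)
    (E : ℝ → (EucV n →L[ℝ] EucV n)) (hE : Continuous E)
    (C₀ : ℝ) (hC₀ : 0 < C₀)
    (hEb : ∀ t : ℝ, ‖E t‖ ≤ C₀ * Real.exp (-|t|))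
    (xp xm : Fin n → ℝ → EucV n)
    (hxp : ∀ j, IsSol n E (xp j)) (hxm : ∀ j, IsSol n E (xm j))
    (hxpAsymp : ∀ j, Tendsto (fun t : ℝ => Real.exp (-t) • xp j t) atTop (𝓝 (eVec n 1 j)))
    (hxmAsymp : ∀ j, Tendsto (fun t : ℝ => Real.exp t • xm j t) atTop (𝓝 (eVec n (-1) j)))
    (htrans : ∀ mu : EuclideanSpace ℝ (Fin n), mu ≠ 0 →
      ¬ Tendsto (fun t : ℝ => ∑ j : Fin n, mu j • xm j t) atBot (𝓝 0)) :
    ∃ k : ℝ, 0 < k ∧ ∀ (mu : EuclideanSpace ℝ (Fin n)) (t : ℝ),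
      k * ‖mu‖ * Real.exp (-t) ≤ ‖∑ j : Fin n, mu j • xm j t‖ := by
  have hE0 : ∀ t ≤ 0, ‖E t‖ ≤ C₀ * exp t := fun t ht => by
    simpa [abs_of_nonpos ht] using hEb t
  have hEC : ∀ t, ‖E t‖ ≤ C₀ := fun t =>
    (hEb t).trans (mul_le_of_le_one_right hC₀.le (exp_le_one_iff.2 (neg_nonpos.2 (abs_nonneg t))))
  have htrans' : ∀ mu : EuclideanSpace ℝ (Fin n),
      Tendsto (fun t : ℝ => ∑ j : Fin n, mu j • xm j t) atBot (𝓝 0) → mu = 0 := fun mu h =>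
    by_contra fun hmu => htrans mu hmu h
  have hscale : ∀ (mu : EuclideanSpace ℝ (Fin n)) (t : ℝ),
      ∑ j, mu j • exp t • xm j t = exp t • ∑ j, mu j • xm j t := fun mu t => by
    rw [Finset.smul_sum]
    exact Finset.sum_congr rfl fun j _ => smul_comm _ _ _
  choose L hL using fun j => exists_tendsto_atBot_of_rescaled_solution (Amap_Amap n) (norm_Amap n)
    hE0 (hxm j).hasDerivAt_exp_smul
  obtain ⟨c, hc, h⟩ := exists_mul_norm_le_norm_sum (v := fun t j => exp t • xm j t)
    (fun j => continuous_iff_continuousAt.2 fun t => ((hxm j).hasDerivAt_exp_smul t).continuousAt)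
    hL hxmAsymp
    (fun t mu hmu => by
      rw [hscale, smul_eq_zero_iff_right (exp_ne_zero t)] at hmu
      have h0 := (IsSol.sum_smul hxm mu).eq_zero hEC hmu
      apply htrans'
      rw [h0]
      exact tendsto_const_nhds)
    (fun mu hmu => by
      have hlim : Tendsto (fun t => ∑ j, mu j • exp t • xm j t) atBot (𝓝 0) := by
        rw [← hmu]
        exact tendsto_finsetSum _ fun j _ => (hL j).const_smul (mu j)
      simp only [hscale] at hlim
      have h0 := tendsto_exp_neg_smul_of_rescaled_solution (Amap_Amap n) (norm_Amap n) hE0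
        (IsSol.sum_smul hxm mu).hasDerivAt_exp_smul hlim
      apply htrans'
      simpa [smul_smul, ← exp_add] using h0)
    eq_zero_of_sum_smul_eVec_eq_zero
  refine ⟨c, hc, fun mu t => ?_⟩
  have ht := h mu t
  rw [hscale, norm_smul, norm_of_nonneg (exp_pos t).le] at ht
  rw [exp_neg, ← div_eq_mul_inv]
  exact (div_le_iff₀' (exp_pos t)).2 ht

end
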